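/- (Claim on the ρ-derivative of J) For every ρ ∈ (−1,1) and every (x,y) ∈ (0,1)², the partial derivative of J_ρ(x,y) with respect to ρ satisfies |∂J_ρ(x,y)/∂ρ| ≤ (1 − ρ²)^{−3/2}. -/

import Mathlib

open MeasureTheory

noncomputable section
namespace DMN

/-- The standard normal CDF `Φ`. -/
def Phi (t : ℝ) : ℝ := ∫ s in Set.Iic t, Real.exp (-s ^ 2 / 2) / Real.sqrt (2 * Real.pi)

/-- The inverse of the standard normal CDF. -/
def PhiInv : ℝ → ℝ := Function.invFun Phi

/-- `J_ρ(x,y) = P[X ≤ Φ⁻¹(x), Y ≤ Φ⁻¹(y)]` for a centered bivariate Gaussian `(X,Y)`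
with unit variances and covariance `ρ`, extended continuously to the boundary of
`[0,1]²`. -/
def J (ρ x y : ℝ) : ℝ :=
  if x = 0 ∨ y = 0 then 0
  else if x = 1 then y
  else if y = 1 then x
  else
    ∫ s in Set.Iic (PhiInv x), ∫ t in Set.Iic (PhiInv y),
      Real.exp (-(s ^ 2 - 2 * ρ * s * t + t ^ 2) / (2 * (1 - ρ ^ 2))) /
        (2 * Real.pi * Real.sqrt (1 - ρ ^ 2))

/-- The standard normal density. -/
def phi (t : ℝ) : ℝ := Real.exp (-t ^ 2 / 2) / Real.sqrt (2 * Real.pi)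

lemma continuous_phi : Continuous phi := by
  unfold phi
  fun_prop

lemma phi_nonneg (t : ℝ) : 0 ≤ phi t := by
  unfold phi
  positivity

lemma one_le_sqrt_two_pi : 1 ≤ Real.sqrt (2 * Real.pi) := by
  rw [Real.one_le_sqrt]
  linarith [Real.pi_gt_three]

lemma phi_le_one (t : ℝ) : phi t ≤ 1 := by
  unfold phi
  rw [div_le_one (by linarith [one_le_sqrt_two_pi])]
  refine le_trans (Real.exp_le_one_iff.2 ?_) one_le_sqrt_two_pi
  linarith [sq_nonneg t]

lemma integrable_phi : Integrable phi := by
  refine ((integrable_exp_neg_mul_sq (b := 1 / 2) (by norm_num)).div_const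
    (Real.sqrt (2 * Real.pi))).congr (.of_forall fun t => ?_)
  simp only [phi]
  ring_nf

lemma integrable_id_mul_phi : Integrable fun t => t * phi t := by
  refine ((integrable_mul_exp_neg_mul_sq (b := 1 / 2) (by norm_num)).div_const
    (Real.sqrt (2 * Real.pi))).congr (.of_forall fun t => ?_)
  simp only [phi]
  ring_nf

lemma Phi_eq (t : ℝ) : Phi t = ∫ s in Set.Iic t, phi s := rfl

lemma hasDerivAt_phi (t : ℝ) : HasDerivAt phi (-t * phi t) t := by
  have h : HasDerivAt (fun u : ℝ => -u ^ 2 / 2) (-t) t := by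
    refine (((hasDerivAt_pow 2 t).neg).div_const 2).congr_deriv ?_
    norm_num
    ring
  refine (h.exp.div_const (Real.sqrt (2 * Real.pi))).congr_deriv ?_
  simp only [phi]
  ring

lemma hasDerivAt_Phi (t : ℝ) : HasDerivAt Phi (phi t) t := by
  have h : Phi = fun u => (∫ s in (0 : ℝ)..u, phi s) + Phi 0 := by
    funext u
    rw [Phi_eq, Phi_eq, ← intervalIntegral.integral_Iic_sub_Iic integrable_phi.integrableOn
      integrable_phi.integrableOn]
    ring
  rw [h]
  exact (continuous_phi.integral_hasStrictDerivAt 0 t).hasDerivAt.add_const _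

lemma continuous_Phi : Continuous Phi :=
  continuous_iff_continuousAt.2 fun t => (hasDerivAt_Phi t).continuousAt

lemma abs_Phi_le (t : ℝ) : |Phi t| ≤ ∫ s, phi s := by
  rw [Phi_eq, abs_of_nonneg (integral_nonneg phi_nonneg)]
  exact setIntegral_le_integral integrable_phi (.of_forall phi_nonneg)

/-- Change of variables for the affine rescaling of the normal density. -/
lemma integral_Iic_phi_affine (b c : ℝ) {σ : ℝ} (hσ : 0 < σ) :
    ∫ t in Set.Iic b, phi ((t - c) / σ) / σ = Phi ((b - c) / σ) := by
  rw [Phi_eq, ← integral_indicator measurableSet_Iic, ← integral_indicator measurableSet_Iic]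
  have h : (Set.Iic b).indicator (fun t => phi ((t - c) / σ) / σ) =
      fun t => (Set.Iic ((b - c) / σ)).indicator phi ((t - c) / σ) / σ := by
    funext t
    simp only [Set.indicator, Set.mem_Iic, div_le_div_iff_of_pos_right hσ, sub_le_sub_iff_right]
    split_ifs <;> simp
  rw [h, integral_div,
    integral_sub_right_eq_self (fun t => (Set.Iic ((b - c) / σ)).indicator phi (t / σ)) c,
    Measure.integral_comp_div, abs_of_pos hσ, smul_eq_mul]
  field_simp

/-- The bivariate normal density factors into marginal and conditional densities. -/
lemma bivariate_density_eq {r : ℝ} (hr : 0 < 1 - r ^ 2) (s t : ℝ) :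
    Real.exp (-(s ^ 2 - 2 * r * s * t + t ^ 2) / (2 * (1 - r ^ 2))) /
        (2 * Real.pi * Real.sqrt (1 - r ^ 2)) =
      phi s * (phi ((t - r * s) / Real.sqrt (1 - r ^ 2)) / Real.sqrt (1 - r ^ 2)) := by
  have h2 : Real.sqrt (2 * Real.pi) * Real.sqrt (2 * Real.pi) = 2 * Real.pi :=
    Real.mul_self_sqrt (by positivity)
  have he : -(s ^ 2 - 2 * r * s * t + t ^ 2) / (2 * (1 - r ^ 2)) =
      -s ^ 2 / 2 + -((t - r * s) / Real.sqrt (1 - r ^ 2)) ^ 2 / 2 := by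
    rw [div_pow, Real.sq_sqrt hr.le]
    field_simp
    ring
  rw [he, Real.exp_add, ← h2]
  simp only [phi]
  have := Real.sqrt_pos.2 hr
  field_simp

lemma integral_bivariate_density {r : ℝ} (hr : 0 < 1 - r ^ 2) (a b : ℝ) :
    (∫ s in Set.Iic a, ∫ t in Set.Iic b,
      Real.exp (-(s ^ 2 - 2 * r * s * t + t ^ 2) / (2 * (1 - r ^ 2))) /
        (2 * Real.pi * Real.sqrt (1 - r ^ 2))) =
      ∫ s in Set.Iic a, phi s * Phi ((b - r * s) / Real.sqrt (1 - r ^ 2)) := by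
  simp_rw [bivariate_density_eq hr, integral_const_mul,
    integral_Iic_phi_affine _ _ (Real.sqrt_pos.2 hr)]

lemma hasDerivAt_sub_mul_div_sqrt {r : ℝ} (hr : 0 < 1 - r ^ 2) (b s : ℝ) :
    HasDerivAt (fun r => (b - r * s) / Real.sqrt (1 - r ^ 2))
      ((r * b - s) / Real.sqrt (1 - r ^ 2) ^ 3) r := by
  have h1 : HasDerivAt (fun r : ℝ => b - r * s) (-s) r := by
    simpa using ((hasDerivAt_id r).mul_const s).const_sub b
  have h2 : HasDerivAt (fun r : ℝ => 1 - r ^ 2) (-(2 * r)) r := by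
    simpa using (hasDerivAt_pow 2 r).const_sub 1
  have hσ := Real.sqrt_pos.2 hr
  refine (h1.div (h2.sqrt hr.ne') hσ.ne').congr_deriv ?_
  have hsq := Real.sq_sqrt hr.le
  set σ := Real.sqrt (1 - r ^ 2)
  field_simp
  rw [hsq]
  ring

/-- `∂Φ_ρ(a,b)/∂ρ` is the bivariate normal density at `(a,b)`. -/
lemma hasDerivAt_integral_phi_mul_Phi {ρ : ℝ} (hρ : |ρ| < 1) (a b : ℝ) :
    HasDerivAt (fun r => ∫ s in Set.Iic a, phi s * Phi ((b - r * s) / Real.sqrt (1 - r ^ 2)))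
      (phi a * (phi ((b - ρ * a) / Real.sqrt (1 - ρ ^ 2)) / Real.sqrt (1 - ρ ^ 2))) ρ := by
  obtain ⟨m, hρm, hm1⟩ := exists_between hρ
  have hm0 : 0 < m := (abs_nonneg ρ).trans_lt hρm
  have hm : 0 < 1 - m ^ 2 := by nlinarith
  have hle : ∀ r ∈ Set.Ioo (-m) m, 1 - m ^ 2 ≤ 1 - r ^ 2 := fun r hr => by
    nlinarith [hr.1, hr.2]
  have hρmem : ρ ∈ Set.Ioo (-m) m := abs_lt.1 hρm
  have hρpos : 0 < 1 - ρ ^ 2 := hm.trans_le (hle ρ hρmem)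
  have hc := Real.sqrt_pos.2 hm
  set c := Real.sqrt (1 - m ^ 2)
  let F' : ℝ → ℝ → ℝ := fun r s => phi s * (phi ((b - r * s) / Real.sqrt (1 - r ^ 2)) *
    ((r * b - s) / Real.sqrt (1 - r ^ 2) ^ 3))
  have hmeas : ∀ r : ℝ, AEStronglyMeasurable
      (fun s => phi s * Phi ((b - r * s) / Real.sqrt (1 - r ^ 2)))
      (volume.restrict (Set.Iic a)) := fun r =>
    (continuous_phi.mul (continuous_Phi.comp (by fun_prop))).aestronglyMeasurable
  obtain ⟨hint, hderiv⟩ := hasDerivAt_integral_of_dominated_loc_of_deriv_le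
    (μ := volume.restrict (Set.Iic a)) (x₀ := ρ) (s := Set.Ioo (-m) m)
    (F := fun r s => phi s * Phi ((b - r * s) / Real.sqrt (1 - r ^ 2)))
    (F' := F') (bound := fun s => (|b| * phi s + |s * phi s|) / c ^ 3)
    (Ioo_mem_nhds hρmem.1 hρmem.2) (.of_forall hmeas)
    (by
      refine (integrable_phi.mul_const (∫ s, phi s)).integrableOn.mono' (hmeas ρ)
        (.of_forall fun s => ?_)
      rw [norm_mul, Real.norm_of_nonneg (phi_nonneg s)]
      exact mul_le_mul_of_nonneg_left (abs_Phi_le _) (phi_nonneg s))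
    (by
      refine Continuous.aestronglyMeasurable ?_
      exact continuous_phi.mul ((continuous_phi.comp (by fun_prop)).mul (by fun_prop)))
    (by
      refine .of_forall fun s r hr => ?_
      have hcr : c ≤ Real.sqrt (1 - r ^ 2) := Real.sqrt_le_sqrt (hle r hr)
      have hnum : |r * b - s| ≤ |b| + |s| := by
        refine (abs_sub _ _).trans ?_
        rw [abs_mul]
        have : |r| ≤ 1 := (abs_lt.2 hr).le.trans hm1.le
        gcongr
        exact mul_le_of_le_one_left (abs_nonneg b) this
      have hσ : 0 < Real.sqrt (1 - r ^ 2) := hc.trans_le hcr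
      calc ‖F' r s‖ = phi s * (phi ((b - r * s) / Real.sqrt (1 - r ^ 2)) *
            (|r * b - s| / Real.sqrt (1 - r ^ 2) ^ 3)) := by
              simp only [F', Real.norm_eq_abs, abs_mul, abs_div, abs_of_nonneg (phi_nonneg _),
                abs_of_pos (pow_pos hσ 3)]
        _ ≤ phi s * (1 * ((|b| + |s|) / c ^ 3)) := by
              have := phi_nonneg s
              gcongr
              exact phi_le_one _
        _ = (|b| * phi s + |s * phi s|) / c ^ 3 := by
              rw [abs_mul, abs_of_nonneg (phi_nonneg s)]
              ring)
    (((integrable_phi.const_mul |b|).add integrable_id_mul_phi.abs).div_const _).integrableOn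
    (by
      refine .of_forall fun s r hr => ?_
      exact ((hasDerivAt_Phi _).comp r
        (hasDerivAt_sub_mul_div_sqrt (hm.trans_le (hle r hr)) b s)).const_mul (phi s))
  refine hderiv.congr_deriv ?_
  have hσ := Real.sqrt_pos.2 hρpos
  have hprim : ∀ s, HasDerivAt
      (fun s => phi s * (phi ((b - ρ * s) / Real.sqrt (1 - ρ ^ 2)) / Real.sqrt (1 - ρ ^ 2)))
      (F' ρ s) s := fun s => by
    have h1 : HasDerivAt (fun s : ℝ => (b - ρ * s) / Real.sqrt (1 - ρ ^ 2))
        (-ρ / Real.sqrt (1 - ρ ^ 2)) s := by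
      simpa using (((hasDerivAt_id s).const_mul ρ).const_sub b).div_const (Real.sqrt (1 - ρ ^ 2))
    refine ((hasDerivAt_phi s).mul
      (((hasDerivAt_phi _).comp s h1).div_const (Real.sqrt (1 - ρ ^ 2)))).congr_deriv ?_
    have hsq := Real.sq_sqrt hρpos.le
    simp only [F', Function.comp_apply]
    set σ := Real.sqrt (1 - ρ ^ 2)
    generalize phi ((b - ρ * s) / σ) = p
    field_simp
    rw [hsq]
    ring
  have hprim_int : IntegrableOn
      (fun s => phi s * (phi ((b - ρ * s) / Real.sqrt (1 - ρ ^ 2)) / Real.sqrt (1 - ρ ^ 2)))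
      (Set.Iic a) := by
    refine (integrable_phi.mul_const (1 / Real.sqrt (1 - ρ ^ 2))).integrableOn.mono'
      (Continuous.aestronglyMeasurable ?_) (.of_forall fun s => ?_)
    · exact continuous_phi.mul ((continuous_phi.comp (by fun_prop)).div_const _)
    · have h0 := phi_nonneg s
      have h1 := phi_nonneg ((b - ρ * s) / Real.sqrt (1 - ρ ^ 2))
      rw [Real.norm_of_nonneg (by positivity)]
      gcongr
      exact phi_le_one _
  have := integral_Iic_of_hasDerivAt_of_tendsto' (fun s _ => hprim s) hint
    (tendsto_zero_of_hasDerivAt_of_integrableOn_Iic (fun s _ => hprim s) hint hprim_int)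
  simpa using this

/-- **Claim on the ρ-derivative of `J`**: `|∂J_ρ(x,y)/∂ρ| ≤ (1-ρ²)^{-3/2}`. -/
theorem deriv_J_rho_bound (ρ : ℝ) (hρ0 : -1 < ρ) (hρ1 : ρ < 1) (x y : ℝ)
    (hx : x ∈ Set.Ioo (0 : ℝ) 1) (hy : y ∈ Set.Ioo (0 : ℝ) 1) :
    |deriv (fun r => J r x y) ρ| ≤ (1 - ρ ^ 2) ^ (-(3 : ℝ) / 2) := by
  have hpos : 0 < 1 - ρ ^ 2 := by nlinarith
  have hJ : (fun r => J r x y) =ᶠ[nhds ρ] fun r => ∫ s in Set.Iic (PhiInv x),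
      phi s * Phi ((PhiInv y - r * s) / Real.sqrt (1 - r ^ 2)) := by
    filter_upwards [Ioo_mem_nhds hρ0 hρ1] with r hr
    have hr' : 0 < 1 - r ^ 2 := by nlinarith [hr.1, hr.2]
    rw [← integral_bivariate_density hr']
    simp [J, hx.1.ne', hx.2.ne, hy.1.ne', hy.2.ne]
  rw [hJ.deriv_eq, (hasDerivAt_integral_phi_mul_Phi (abs_lt.2 ⟨hρ0, hρ1⟩) _ _).deriv]
  have hσ := Real.sqrt_pos.2 hpos
  have hp := phi_nonneg (PhiInv x)
  have hq := phi_nonneg ((PhiInv y - ρ * PhiInv x) / Real.sqrt (1 - ρ ^ 2))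
  rw [abs_of_nonneg (by positivity)]
  calc _ ≤ 1 * (1 / Real.sqrt (1 - ρ ^ 2)) := by
        gcongr <;> exact phi_le_one _
    _ = (1 - ρ ^ 2) ^ (-(1 : ℝ) / 2) := by
        rw [neg_div, Real.rpow_neg hpos.le, Real.sqrt_eq_rpow]
        simp
    _ ≤ (1 - ρ ^ 2) ^ (-(3 : ℝ) / 2) :=
        Real.rpow_le_rpow_of_exponent_ge hpos (by linarith [sq_nonneg ρ]) (by norm_num)

end DMN
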